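/- Let ρ* > 0, let P : (0,∞) → ℝ be continuously differentiable with P' > 0, set h(z) = ∫_{ρ*}^{z} P'(s)/s ds, and let g, b > 0. If ρ̄ : [-b,0] → (0,∞) is continuously differentiable and satisfies (d/dy)(P(ρ̄(y))) = -g·ρ̄(y) for all y ∈ (-b,0) together with P(ρ̄(0)) = P(ρ*), then h(ρ̄(y)) = -g·y for every y ∈ [-b,0]. Consequently such a solution is unique, it is strictly decreasing with values in [ρ*,∞), and necessarily g·b = h(ρ̄(-b)) < ∫_{ρ*}^{∞} P'(s)/s ds. -/

import Mathlib

open MeasureTheory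

/-- The enthalpy `z ↦ ∫_{a}^{z} P'(s)/s ds` has derivative `P'(z)/z` on `(0,∞)`. -/
theorem hasDerivAt_enthalpy {P' : ℝ → ℝ} (hP' : ContinuousOn P' (Set.Ioi 0))
    {a z : ℝ} (ha : 0 < a) (hz : 0 < z) :
    HasDerivAt (fun z => ∫ s in a..z, P' s / s) (P' z / z) z := by
  have hc : ContinuousOn (fun s => P' s / s) (Set.Ioi 0) :=
    hP'.div continuousOn_id fun s hs => ne_of_gt hs
  refine intervalIntegral.integral_hasDerivAt_right ?_
    (hc.stronglyMeasurableAtFilter isOpen_Ioi z hz) (hc.continuousAt (Ioi_mem_nhds hz))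
  exact (hc.mono fun s hs => lt_of_lt_of_le (lt_min ha hz) hs.1).intervalIntegrable

/-- A function with positive derivative on `(0,∞)` is strictly increasing there. -/
theorem strictMonoOn_Ioi_of_hasDerivAt_pos {f f' : ℝ → ℝ}
    (hf : ∀ s ∈ Set.Ioi (0 : ℝ), HasDerivAt f (f' s) s)
    (hf' : ∀ s ∈ Set.Ioi (0 : ℝ), 0 < f' s) : StrictMonoOn f (Set.Ioi 0) := by
  refine strictMonoOn_of_deriv_pos (convex_Ioi 0)
    (fun s hs => (hf s hs).continuousAt.continuousWithinAt) fun s hs => ?_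
  rw [interior_Ioi] at hs
  rw [(hf s hs).deriv]
  exact hf' s hs

/-- Along a positive solution of the hydrostatic equation, the enthalpy is affine in depth. -/
theorem enthalpy_comp_eq_of_hydrostatic {P P' h σ : ℝ → ℝ} {ρstar g b : ℝ} (hρstar : 0 < ρstar)
    (hP : ∀ s ∈ Set.Ioi (0 : ℝ), HasDerivAt P (P' s) s)
    (hP'pos : ∀ s ∈ Set.Ioi (0 : ℝ), 0 < P' s)
    (hh : ∀ z ∈ Set.Ioi (0 : ℝ), HasDerivAt h (P' z / z) z) (hzero : h ρstar = 0)
    (hb : 0 < b) (hreg : ContDiffOn ℝ 1 σ (Set.Icc (-b) 0))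
    (hpos : ∀ y ∈ Set.Icc (-b) (0 : ℝ), 0 < σ y)
    (hode : ∀ y ∈ Set.Ioo (-b) (0 : ℝ), HasDerivAt (fun t => P (σ t)) (-(g * σ y)) y)
    (hbc : P (σ 0) = P ρstar) :
    ∀ y ∈ Set.Icc (-b) (0 : ℝ), h (σ y) = -(g * y) := by
  have hσ0 : σ 0 = ρstar := (strictMonoOn_Ioi_of_hasDerivAt_pos hP hP'pos).injOn
    (hpos 0 ⟨by linarith, le_rfl⟩) hρstar hbc
  have hcont : ContinuousOn (fun t => h (σ t)) (Set.Icc (-b) 0) := fun t ht =>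
    (hh _ (hpos t ht)).continuousAt.comp_continuousWithinAt (hreg.continuousOn t ht)
  have hderiv : ∀ t ∈ Set.Ioo (-b) (0 : ℝ), HasDerivAt (fun t => h (σ t)) (-g) t := by
    intro t ht
    have hpt : 0 < σ t := hpos t (Set.Ioo_subset_Icc_self ht)
    have hd : HasDerivAt σ (deriv σ t) t :=
      ((hreg.differentiableOn one_ne_zero).differentiableAt
        (Icc_mem_nhds ht.1 ht.2)).hasDerivAt
    have heq : P' (σ t) * deriv σ t = -(g * σ t) :=
      ((hP _ hpt).comp t hd).unique (hode t ht)
    have hslope : P' (σ t) / σ t * deriv σ t = -g := by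
      rw [div_mul_eq_mul_div, heq]
      field_simp
    exact hslope ▸ (hh _ hpt).comp t hd
  intro y hy
  rcases hy.2.eq_or_lt with rfl | hy0
  · simp [hσ0, hzero]
  · obtain ⟨c, -, hc⟩ := exists_hasDerivAt_eq_slope (fun t => h (σ t)) (fun _ => -g) hy0
      (hcont.mono (Set.Icc_subset_Icc_left hy.1))
      fun t ht => hderiv t ⟨hy.1.trans_lt ht.1, ht.2⟩
    rw [eq_div_iff (by linarith), hσ0, hzero] at hc
    linarith

/-- Uniqueness of the hydrostatic equilibrium density profile:
any positive continuously differentiable solution `ρ̄` of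
`(P ∘ ρ̄)' = -g ρ̄` on `(-b,0)` with `P(ρ̄(0)) = P(ρ*)` satisfies
`h(ρ̄(y)) = -g y` on `[-b,0]`; consequently it is unique, strictly decreasing,
takes values in `[ρ*,∞)`, and necessarily
`g·b = h(ρ̄(-b)) < ∫_{ρ*}^{∞} P'(s)/s ds`. -/
theorem equilibrium_density_unique
    (ρstar : ℝ) (hρstar : 0 < ρstar)
    (P P' : ℝ → ℝ)
    (hP : ∀ s ∈ Set.Ioi (0 : ℝ), HasDerivAt P (P' s) s)
    (hP'cont : ContinuousOn P' (Set.Ioi 0))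
    (hP'pos : ∀ s ∈ Set.Ioi (0 : ℝ), 0 < P' s)
    (h : ℝ → ℝ)
    (hdef : ∀ z : ℝ, h z = ∫ s in ρstar..z, P' s / s)
    (g b : ℝ) (hg : 0 < g) (hb : 0 < b)
    (ρbar : ℝ → ℝ)
    (hreg : ContDiffOn ℝ 1 ρbar (Set.Icc (-b) 0))
    (hpos : ∀ y ∈ Set.Icc (-b) (0 : ℝ), 0 < ρbar y)
    (hode : ∀ y ∈ Set.Ioo (-b) (0 : ℝ),
      HasDerivAt (fun t => P (ρbar t)) (-(g * ρbar y)) y)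
    (hbc : P (ρbar 0) = P ρstar) :
    (∀ y ∈ Set.Icc (-b) (0 : ℝ), h (ρbar y) = -(g * y)) ∧
    (∀ σ : ℝ → ℝ, ContDiffOn ℝ 1 σ (Set.Icc (-b) 0) →
      (∀ y ∈ Set.Icc (-b) (0 : ℝ), 0 < σ y) →
      (∀ y ∈ Set.Ioo (-b) (0 : ℝ),
        HasDerivAt (fun t => P (σ t)) (-(g * σ y)) y) →
      P (σ 0) = P ρstar →
      ∀ y ∈ Set.Icc (-b) (0 : ℝ), σ y = ρbar y) ∧
    StrictAntiOn ρbar (Set.Icc (-b) 0) ∧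
    (∀ y ∈ Set.Icc (-b) (0 : ℝ), ρstar ≤ ρbar y) ∧
    g * b = h (ρbar (-b)) ∧
    ENNReal.ofReal (g * b) < ∫⁻ s in Set.Ioi ρstar, ENNReal.ofReal (P' s / s) := by
  have hh : ∀ z ∈ Set.Ioi (0 : ℝ), HasDerivAt h (P' z / z) z := fun z hz => by
    rw [funext hdef]
    exact hasDerivAt_enthalpy hP'cont hρstar hz
  have hmono : StrictMonoOn h (Set.Ioi 0) :=
    strictMonoOn_Ioi_of_hasDerivAt_pos hh fun s hs => div_pos (hP'pos s hs) hs
  have hzero : h ρstar = 0 := by simp [hdef]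
  have hρ := enthalpy_comp_eq_of_hydrostatic hρstar hP hP'pos hh hzero hb hreg hpos hode hbc
  have hmem : -b ∈ Set.Icc (-b) (0 : ℝ) := ⟨le_rfl, by linarith⟩
  have hge : ∀ y ∈ Set.Icc (-b) (0 : ℝ), ρstar ≤ ρbar y := fun y hy => by
    rw [← hmono.le_iff_le hρstar (hpos y hy), hzero, hρ y hy]
    nlinarith [hy.2]
  have hgb : g * b = h (ρbar (-b)) := by rw [hρ _ hmem]; ring
  refine ⟨hρ, ?_, ?_, hge, hgb, ?_⟩
  · intro σ hσreg hσpos hσode hσbc y hy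
    refine hmono.injOn (hσpos y hy) (hpos y hy) ?_
    rw [hρ y hy]
    exact enthalpy_comp_eq_of_hydrostatic hρstar hP hP'pos hh hzero hb hσreg hσpos hσode hσbc y hy
  · intro x hx y hy hxy
    rw [← hmono.lt_iff_lt (hpos y hy) (hpos x hx), hρ x hx, hρ y hy]
    nlinarith
  · set M := ρbar (-b) + 1
    have hM : ρstar ≤ M := by linarith [hge _ hmem]
    have hMpos : 0 < M := hρstar.trans_le hM
    have hlt : g * b < h M := hgb ▸ hmono (hpos _ hmem) hMpos (lt_add_one _)
    have hint : IntegrableOn (fun s => P' s / s) (Set.Ioc ρstar M) := by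
      rw [← intervalIntegrable_iff_integrableOn_Ioc_of_le hM]
      refine ContinuousOn.intervalIntegrable_of_Icc hM ?_
      exact (hP'cont.div continuousOn_id fun s hs => ne_of_gt hs).mono
        fun s hs => hρstar.trans_le hs.1
    have hnonneg : 0 ≤ᵐ[volume.restrict (Set.Ioc ρstar M)] fun s => P' s / s := by
      filter_upwards [ae_restrict_mem measurableSet_Ioc] with s hs
      have hs0 : 0 < s := hρstar.trans hs.1
      exact (div_pos (hP'pos s hs0) hs0).le
    calc ENNReal.ofReal (g * b) < ENNReal.ofReal (h M) :=
          (ENNReal.ofReal_lt_ofReal_iff ((mul_pos hg hb).trans hlt)).2 hlt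
      _ = ∫⁻ s in Set.Ioc ρstar M, ENNReal.ofReal (P' s / s) := by
          rw [hdef, intervalIntegral.integral_of_le hM,
            ofReal_integral_eq_lintegral_ofReal hint hnonneg]
      _ ≤ ∫⁻ s in Set.Ioi ρstar, ENNReal.ofReal (P' s / s) :=
          lintegral_mono_set Set.Ioc_subset_Ioi_self
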